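/- arXiv:2203.04065 — 4 statements merged into one kernel-verified Lean document; each statement's English description precedes it below -/
import Mathlib

section
/- For every α ∈ (0,1) and every data vector (Y_1,…,Y_n) ∈ {0,1}^n, the three confidence bands are nested: L^{α,YB}(x) ≤ L^{α,nc}(x) ≤ L^{α,raw}(x) and U^{α,raw}(x) ≤ U^{α,nc}(x) ≤ U^{α,YB}(x) for all x ∈ ℝ, where L^{α,nc} = min(L^{α,raw}, p̂) and U^{α,nc} = max(U^{α,raw}, p̂) pointwise. -/
open MeasureTheory Finset

/-- Binomial cumulative distribution function `pbin(z, m, ξ)`. -/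
noncomputable def pbin (z m : ℕ) (ξ : ℝ) : ℝ :=
  ∑ t ∈ Finset.range (z + 1), (m.choose t : ℝ) * ξ ^ t * (1 - ξ) ^ (m - t)

/-- Clopper–Pearson upper bound `u^δ(z, m)`. -/
noncomputable def cpUpper (δ : ℝ) (z m : ℕ) : ℝ :=
  sSup {ξ : ℝ | ξ ∈ Set.Icc (0 : ℝ) 1 ∧ δ ≤ pbin z m ξ}

/-- Clopper–Pearson lower bound `ℓ^δ(z, m)`, with `ℓ^δ(0, m) := 0`. -/
noncomputable def cpLower (δ : ℝ) (z m : ℕ) : ℝ :=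
  if z = 0 then 0 else sInf {ξ : ℝ | ξ ∈ Set.Icc (0 : ℝ) 1 ∧ pbin (z - 1) m ξ ≤ 1 - δ}

/-- The set `J` of index pairs `(j,k)` with `j ≤ k`, `x_{j-1} < x_j` and `x_k < x_{k+1}`
(the boundary conditions being vacuous for the extreme indices, i.e. `x_0 = -∞`,
`x_{n+1} = ∞`). -/
def idxJ (n : ℕ) (x : Fin n → ℝ) : Set (Fin n × Fin n) :=
  {jk | jk.1 ≤ jk.2 ∧ (∀ i : Fin n, (i : ℕ) + 1 = (jk.1 : ℕ) → x i < x jk.1) ∧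
    (∀ i : Fin n, (jk.2 : ℕ) + 1 = (i : ℕ) → x jk.2 < x i)}

/-- `N`, the number of distinct covariate values. -/
noncomputable def distinctN (n : ℕ) (x : Fin n → ℝ) : ℕ := (Finset.univ.image x).card

/-- The corrected level `α / (N² + N)`. -/
noncomputable def deltaN (n : ℕ) (x : Fin n → ℝ) (α : ℝ) : ℝ :=
  α / ((distinctN n x : ℝ) ^ 2 + (distinctN n x : ℝ))

/-- The upper band `U^{α,raw}` for the (deterministic) data vector `Y ∈ {0,1}^n`,
with `inf ∅ := 1`. -/
noncomputable def Uraw (n : ℕ) (x : Fin n → ℝ) (Y : Fin n → ℕ) (α : ℝ) (t : ℝ) : ℝ :=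
  sInf (insert (1 : ℝ) {u : ℝ | ∃ jk ∈ idxJ n x, t ≤ x jk.1 ∧
    u = cpUpper (deltaN n x α) (∑ i ∈ Finset.Icc jk.1 jk.2, Y i)
          ((jk.2 : ℕ) - (jk.1 : ℕ) + 1)})

/-- The lower band `L^{α,raw}` for the (deterministic) data vector `Y ∈ {0,1}^n`,
with `sup ∅ := 0`. -/
noncomputable def Lraw (n : ℕ) (x : Fin n → ℝ) (Y : Fin n → ℕ) (α : ℝ) (t : ℝ) : ℝ :=
  sSup (insert (0 : ℝ) {u : ℝ | ∃ jk ∈ idxJ n x, x jk.2 ≤ t ∧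
    u = cpLower (deltaN n x α) (∑ i ∈ Finset.Icc jk.1 jk.2, Y i)
          ((jk.2 : ℕ) - (jk.1 : ℕ) + 1)})

/-- An isotonic function `phat : ℝ → [0,1]` minimizing `Σ (Y_i - h(x_i))²` over all
isotonic functions `h : ℝ → [0,1]` (the isotonic least-squares fit). -/
def IsIsoFit01 (n : ℕ) (x : Fin n → ℝ) (Y : Fin n → ℝ) (phat : ℝ → ℝ) : Prop :=
  Monotone phat ∧ (∀ t, phat t ∈ Set.Icc (0 : ℝ) 1) ∧
    ∀ h : ℝ → ℝ, Monotone h → (∀ t, h t ∈ Set.Icc (0 : ℝ) 1) →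
      ∑ i, (Y i - phat (x i)) ^ 2 ≤ ∑ i, (Y i - h (x i)) ^ 2

/-- The upper Yang–Barber band `U^{α,YB}`, with `inf ∅ := 1`. -/
noncomputable def Uyb (n : ℕ) (x : Fin n → ℝ) (phat : ℝ → ℝ) (α : ℝ) (t : ℝ) : ℝ :=
  sInf (insert (1 : ℝ) {u : ℝ | ∃ jk ∈ idxJ n x, t ≤ x jk.1 ∧
    u = (∑ i ∈ Finset.Icc jk.1 jk.2, phat (x i)) / (((jk.2 : ℕ) - (jk.1 : ℕ) + 1 : ℕ) : ℝ) +
      Real.sqrt (Real.log (((distinctN n x : ℝ) ^ 2 + (distinctN n x : ℝ)) / α) /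
        (2 * (((jk.2 : ℕ) - (jk.1 : ℕ) + 1 : ℕ) : ℝ)))})

/-- The lower Yang–Barber band `L^{α,YB}`, with `sup ∅ := 0`. -/
noncomputable def Lyb (n : ℕ) (x : Fin n → ℝ) (phat : ℝ → ℝ) (α : ℝ) (t : ℝ) : ℝ :=
  sSup (insert (0 : ℝ) {u : ℝ | ∃ jk ∈ idxJ n x, x jk.2 ≤ t ∧
    u = (∑ i ∈ Finset.Icc jk.1 jk.2, phat (x i)) / (((jk.2 : ℕ) - (jk.1 : ℕ) + 1 : ℕ) : ℝ) -
      Real.sqrt (Real.log (((distinctN n x : ℝ) ^ 2 + (distinctN n x : ℝ)) / α) /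
        (2 * (((jk.2 : ℕ) - (jk.1 : ℕ) + 1 : ℕ) : ℝ)))})

theorem bernoulli_mgf_le {ξ : ℝ} (h0 : 0 ≤ ξ) (h1 : ξ ≤ 1) (s : ℝ) :
    ξ * Real.exp s + (1 - ξ) ≤ Real.exp (s * ξ + s ^ 2 / 8) := by
  let μ : Measure ℝ :=
    ENNReal.ofReal ξ • Measure.dirac 1 + ENNReal.ofReal (1 - ξ) • Measure.dirac 0
  have hμ : IsProbabilityMeasure μ := ⟨by
    simp [μ, ← ENNReal.ofReal_add h0 (sub_nonneg.2 h1)]⟩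
  have hint (f : ℝ → ℝ) : ∫ y, f y ∂μ = ξ * f 1 + (1 - ξ) * f 0 := by
    rw [integral_add_measure ((integrable_dirac (by simp)).smul_measure (by simp))
      ((integrable_dirac (by simp)).smul_measure (by simp))]
    simp [integral_smul_measure, h0, h1]
  have hb : ∀ᵐ y ∂μ, id y ∈ Set.Icc (0 : ℝ) 1 := by
    simp only [μ, ae_add_measure_iff]
    constructor <;> refine Measure.ae_smul_measure ?_ _ <;> rw [ae_dirac_eq] <;> simp
  have h := (ProbabilityTheory.hasSubgaussianMGF_of_mem_Icc aemeasurable_id hb).mgf_le s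
  rw [ProbabilityTheory.mgf, hint, hint] at h
  simp only [id] at h
  have h2 := mul_le_mul_of_nonneg_left h (Real.exp_pos (s * ξ)).le
  rw [← Real.exp_add] at h2
  rw [mul_add, mul_left_comm, mul_left_comm _ (1 - ξ), ← Real.exp_add, ← Real.exp_add] at h2
  have e1 : s * ξ + s * (1 - (ξ * 1 + (1 - ξ) * 0)) = s := by ring
  have e2 : s * ξ + s * (0 - (ξ * 1 + (1 - ξ) * 0)) = 0 := by ring
  have e3 : s * ξ + ((‖(1 : ℝ) - 0‖₊ / 2) ^ 2 : NNReal) * s ^ 2 / 2 = s * ξ + s ^ 2 / 8 := by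
    simp
    ring
  rwa [e1, e2, e3, Real.exp_zero, mul_one] at h2

theorem pbin_le_exp {z m : ℕ} (hz : z ≤ m) {ξ s : ℝ} (h0 : 0 ≤ ξ) (h1 : ξ ≤ 1) (hs : 0 ≤ s) :
    pbin z m ξ ≤ Real.exp (s * z - m * (s * ξ) + m * (s ^ 2 / 8)) := by
  have h1' : 0 ≤ 1 - ξ := sub_nonneg.2 h1
  calc pbin z m ξ
      ≤ ∑ t ∈ range (z + 1), Real.exp (s * z) *
          ((ξ * Real.exp (-s)) ^ t * (1 - ξ) ^ (m - t) * (m.choose t : ℝ)) := by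
        refine sum_le_sum fun t ht => ?_
        have ht : (t : ℝ) ≤ z := by exact_mod_cast Nat.lt_succ_iff.1 (mem_range.1 ht)
        have : Real.exp (s * z) *
            ((ξ * Real.exp (-s)) ^ t * (1 - ξ) ^ (m - t) * (m.choose t : ℝ)) =
            (m.choose t * ξ ^ t * (1 - ξ) ^ (m - t)) * Real.exp (s * (z - t)) := by
          rw [mul_pow, ← Real.exp_nat_mul, show s * ((z : ℝ) - t) = s * z + t * -s by ring,
            Real.exp_add]
          ring
        rw [this]
        exact le_mul_of_one_le_right (by positivity)
          (Real.one_le_exp (mul_nonneg hs (sub_nonneg.2 ht)))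
    _ ≤ ∑ t ∈ range (m + 1), Real.exp (s * z) *
          ((ξ * Real.exp (-s)) ^ t * (1 - ξ) ^ (m - t) * (m.choose t : ℝ)) :=
        sum_le_sum_of_subset_of_nonneg (range_subset_range.2 (by omega))
          fun t _ _ => by positivity
    _ = Real.exp (s * z) * (ξ * Real.exp (-s) + (1 - ξ)) ^ m := by
        rw [← mul_sum, add_pow]
    _ ≤ Real.exp (s * z) * Real.exp (-s * ξ + (-s) ^ 2 / 8) ^ m := by
        gcongr
        exact bernoulli_mgf_le h0 h1 (-s)
    _ = _ := by
        rw [← Real.exp_nat_mul, ← Real.exp_add]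
        ring_nf

theorem le_of_le_pbin {z m : ℕ} (hm : 0 < m) {ξ δ : ℝ} (hδ : 0 < δ) (h0 : 0 ≤ ξ) (h1 : ξ ≤ 1)
    (h : δ ≤ pbin z m ξ) :
    ξ ≤ z / m + Real.sqrt (Real.log (1 / δ) / (2 * m)) := by
  by_contra! hlt
  have hm' : (0 : ℝ) < m := by exact_mod_cast hm
  have hd : Real.sqrt (Real.log (1 / δ) / (2 * m)) < ξ - z / m := by linarith
  have hd0 : 0 < ξ - z / m := (Real.sqrt_nonneg _).trans_lt hd
  have hz : z ≤ m := by
    have : (z : ℝ) / m < 1 := by linarith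
    rw [div_lt_one hm'] at this
    exact_mod_cast this.le
  have hle := h.trans (pbin_le_exp hz h0 h1 (s := 4 * (ξ - z / m)) (by linarith))
  have hlog := (Real.log_le_iff_le_exp hδ).2 hle
  rw [Real.sqrt_lt' hd0, div_lt_iff₀ (by positivity), one_div, Real.log_inv] at hd
  have : 4 * (ξ - z / m) * z - m * (4 * (ξ - z / m) * ξ) + m * ((4 * (ξ - z / m)) ^ 2 / 8)
      = - ((ξ - z / m) ^ 2 * (2 * m)) := by
    field_simp
    ring
  linarith

theorem pbin_one_sub {z m : ℕ} (hz : z < m) (ξ : ℝ) :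
    pbin (m - (z + 1)) m (1 - ξ) = 1 - pbin z m ξ := by
  have htot : ∑ t ∈ range (m + 1), (m.choose t : ℝ) * ξ ^ t * (1 - ξ) ^ (m - t) = 1 := by
    have := add_pow ξ (1 - ξ) m
    rw [add_sub_cancel, one_pow] at this
    exact (sum_congr rfl fun t _ => by ring).trans this.symm
  have hsplit := sum_range_add_sum_Ico
    (fun t => (m.choose t : ℝ) * ξ ^ t * (1 - ξ) ^ (m - t)) (show z + 1 ≤ m + 1 by omega)
  rw [htot] at hsplit
  rw [pbin, pbin, ← eq_sub_of_add_eq' hsplit]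
  refine sum_nbij' (fun t => m - t) (fun t => m - t) ?_ ?_ ?_ ?_ ?_
  · intro t ht; simp at ht ⊢; omega
  · intro t ht; simp at ht ⊢; omega
  · intro t ht; simp at ht; omega
  · intro t ht; simp at ht; omega
  · intro t ht
    have ht : t ≤ m := by simp at ht; omega
    rw [Nat.choose_symm ht, Nat.sub_sub_self ht, sub_sub_cancel]
    ring

theorem exists_ratio_le_of_break {M : ℕ} {f : ℕ → ℝ} {c : ℝ}
    (hc : 0 ≤ c) (hf : ∀ a b, a ≤ b → b < M → f a ≤ f b) {m : ℕ} (hm0 : 0 < m) (hmM : m ≤ M) :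
    ∃ r, 0 < r ∧ r ≤ M ∧ (r < M → f (r - 1) < f r) ∧
      (∑ i ∈ range r, f i) / r + c / Real.sqrt r ≤ (∑ i ∈ range m, f i) / m + c / Real.sqrt m := by
  let F : ℕ → ℝ := fun k => (∑ i ∈ range k, f i) / k + c / Real.sqrt k
  obtain ⟨q, hq, hqmin⟩ := exists_min_image (Finset.Icc 1 M) F ⟨m, by simp; omega⟩
  obtain ⟨r, hr, hrmax⟩ := exists_max_image {k ∈ Finset.Icc 1 M | F k ≤ F q} id ⟨q, by simpa using hq⟩
  simp only [mem_filter, Finset.mem_Icc] at hr hrmax hqmin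
  refine ⟨r, by omega, by omega, fun hrM => ?_, hr.2.trans (hqmin m ⟨hm0, hmM⟩)⟩
  refine (hf _ _ (Nat.sub_le _ _) hrM).lt_of_ne fun heq => ?_
  have hsucc : F r < F (r + 1) := by
    by_contra! h
    have := hrmax (r + 1) ⟨⟨by omega, by omega⟩, h.trans hr.2⟩
    simp at this
  obtain ⟨k, rfl⟩ : ∃ k, r = k + 1 := ⟨r - 1, by omega⟩
  rw [Nat.add_sub_cancel] at heq
  let p := f k
  let A := k * p - ∑ i ∈ range k, f i
  have hA : 0 ≤ A := by
    have := sum_le_card_nsmul (range k) f p fun i hi => hf i k (mem_range.1 hi).le (by omega)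
    simp at this
    simpa [A] using this
  let u : ℕ → ℝ := fun l => 1 / Real.sqrt l
  have hu : ∀ l : ℕ, 0 < l → u l ^ 2 = 1 / l := fun l _ => by
    simp [u]
  have hlt : ∀ l : ℕ, 0 < l → u (l + 1) < u l := fun l hl => by
    have : (0 : ℝ) < l := by exact_mod_cast hl
    exact one_div_lt_one_div_of_lt (by positivity) (Real.sqrt_lt_sqrt this.le (by simp))
  have hF : ∀ l, 0 < l → k ≤ l → l ≤ k + 2 → F l = p - A * u l ^ 2 + c * u l := by
    intro l hl h1 h2
    have hS : ∑ i ∈ range l, f i = l * p - A := by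
      obtain rfl | rfl | rfl : l = k ∨ l = k + 1 ∨ l = k + 2 := by omega
      · simp [A]
      · simp [A, sum_range_succ, p]; ring
      · simp [A, sum_range_succ, p, ← heq]; ring
    have : (l : ℝ) ≠ 0 := by positivity
    simp only [F]
    rw [hS, hu l hl]
    simp only [u]
    field_simp
  rw [hF _ (by omega) (by omega) (by omega), hF _ (by omega) (by omega) (by omega)] at hsucc
  have h12 := hlt (k + 1) (by omega)
  have key : c < A * (u (k + 1) + u (k + 1 + 1)) := by
    by_contra! h
    nlinarith [mul_nonneg (sub_nonneg.2 h) (sub_nonneg.2 h12.le)]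
  rcases Nat.eq_zero_or_pos k with rfl | hk
  · have : A = 0 := by simp [A]
    rw [this] at key
    linarith
  · have hpred : F (k + 1) ≤ F k := hr.2.trans (hqmin k ⟨hk, by omega⟩)
    rw [hF _ (by omega) (by omega) (by omega), hF _ hk (by omega) (by omega)] at hpred
    have h01 := hlt k hk
    have key2 : A * (u k + u (k + 1)) ≤ c := by
      by_contra! h
      nlinarith [mul_pos (sub_pos.2 h) (sub_pos.2 h01)]
    nlinarith [mul_nonneg hA (sub_nonneg.2 (h12.trans h01).le)]

/-- `p` is the least-squares projection of the responses `y` at the points `x` onto the cone of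
monotone functions, expressed through the variational inequality. -/
def IsIsotonicProjection {ι : Type*} [Fintype ι] (x y : ι → ℝ) (p : ℝ → ℝ) : Prop :=
  Monotone p ∧ ∀ h : ℝ → ℝ, Monotone h → ∑ i, (y i - p (x i)) * (h (x i) - p (x i)) ≤ 0

theorem IsIsotonicProjection.neg {ι : Type*} [Fintype ι] {x y : ι → ℝ} {p : ℝ → ℝ}
    (hp : IsIsotonicProjection x y p) :
    IsIsotonicProjection (fun i => -x i) (fun i => -y i) (fun s => -p (-s)) := by
  refine ⟨fun a b hab => neg_le_neg (hp.1 (neg_le_neg hab)), fun h hh => ?_⟩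
  refine le_of_eq_of_le (sum_congr rfl fun i _ => ?_)
    (hp.2 (fun s => -h (-s)) fun a b hab => neg_le_neg (hh (neg_le_neg hab)))
  simp only [neg_neg]
  ring

theorem IsIsotonicProjection.sum_le {ι : Type*} [Fintype ι] {x y : ι → ℝ} {p : ℝ → ℝ}
    (hp : IsIsotonicProjection x y p) {a B ε : ℝ} (hε : 0 < ε) (s : Finset ι)
    (hs : ∀ i ∈ s, a ≤ x i ∧ p (x i) + ε ≤ B) (hs' : ∀ i ∉ s, x i < a ∨ B ≤ p (x i)) :
    ∑ i ∈ s, y i ≤ ∑ i ∈ s, p (x i) := by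
  classical
  let h : ℝ → ℝ := fun t => if a ≤ t then max (p t) (min (p t + ε) B) else p t
  have hh : Monotone h := by
    intro b c hbc
    have hpbc := hp.1 hbc
    simp only [h]
    split_ifs with h1 h2 h2
    · gcongr
    · exact absurd (h1.trans hbc) h2
    · exact hpbc.trans (le_max_left _ _)
    · exact hpbc
  have hval : ∀ i, h (x i) - p (x i) = if i ∈ s then ε else 0 := by
    intro i
    split_ifs with hi
    · obtain ⟨h1, h2⟩ := hs i hi
      simp [h, h1, h2, hε.le]
    · rcases hs' i hi with h1 | h1
      · simp [h, not_le.2 h1]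
      · simp [h, h1]
  have := hp.2 h hh
  simp only [hval, mul_ite, mul_zero, sum_ite_mem, univ_inter, ← sum_mul, sum_sub_distrib] at this
  nlinarith

theorem IsIsotonicProjection.comp_equiv {ι κ : Type*} [Fintype ι] [Fintype κ] {x y : ι → ℝ}
    {p : ℝ → ℝ} (hp : IsIsotonicProjection x y p) (e : κ ≃ ι) :
    IsIsotonicProjection (x ∘ e) (y ∘ e) p :=
  ⟨hp.1, fun h hh => le_of_eq_of_le
    (e.sum_comp fun i => (y i - p (x i)) * (h (x i) - p (x i))) (hp.2 h hh)⟩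

theorem sq_sub_clip_le {y : ℝ} (hy0 : 0 ≤ y) (hy1 : y ≤ 1) (g : ℝ) :
    (y - max 0 (min 1 g)) ^ 2 ≤ (y - g) ^ 2 := by
  rcases le_total 1 g with h | h
  · rw [min_eq_left h, max_eq_right zero_le_one]
    nlinarith
  · rw [min_eq_right h]
    rcases le_total 0 g with h' | h'
    · rw [max_eq_right h']
    · rw [max_eq_left h']
      nlinarith

theorem IsIsoFit01.isIsotonicProjection {n : ℕ} {x y : Fin n → ℝ} {p : ℝ → ℝ}
    (hp : IsIsoFit01 n x y p) (hy : ∀ i, y i ∈ Set.Icc (0 : ℝ) 1) :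
    IsIsotonicProjection x y p := by
  refine ⟨hp.1, fun h hh => ?_⟩
  set D := ∑ i, (y i - p (x i)) * (h (x i) - p (x i)) with hD
  set Q := ∑ i, (h (x i) - p (x i)) ^ 2 with hQ
  have hQ0 : 0 ≤ Q := sum_nonneg fun i _ => sq_nonneg _
  have hquad : ∀ s : ℝ, 0 ≤ s → s ≤ 1 → 2 * s * D ≤ s ^ 2 * Q := by
    intro s hs0 hs1
    let g : ℝ → ℝ := fun t => (1 - s) * p t + s * h t
    have hg : Monotone g := fun a b hab =>
      add_le_add (mul_le_mul_of_nonneg_left (hp.1 hab) (sub_nonneg.2 hs1))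
        (mul_le_mul_of_nonneg_left (hh hab) hs0)
    have h1 := hp.2.2 (fun t => max 0 (min 1 (g t)))
      (fun a b hab => max_le_max le_rfl (min_le_min le_rfl (hg hab)))
      (fun t => ⟨le_max_left _ _, max_le zero_le_one (min_le_left _ _)⟩)
    have h2 : ∑ i, (y i - max 0 (min 1 (g (x i)))) ^ 2 ≤ ∑ i, (y i - g (x i)) ^ 2 :=
      sum_le_sum fun i _ => sq_sub_clip_le (hy i).1 (hy i).2 _
    have h3 : ∑ i, (y i - g (x i)) ^ 2 =
        ∑ i, (y i - p (x i)) ^ 2 - 2 * s * D + s ^ 2 * Q := by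
      rw [hD, hQ, mul_sum, mul_sum, ← sum_sub_distrib, ← sum_add_distrib]
      exact sum_congr rfl fun i _ => by simp only [g]; ring
    linarith
  by_contra! hpos
  have hDQ : 0 < D + Q := by linarith
  have h1 := hquad (D / (D + Q)) (by positivity) ((div_le_one hDQ).2 (by linarith))
  have h2 : (D / (D + Q)) ^ 2 * Q = D / (D + Q) * D * (Q / (D + Q)) := by
    field_simp
  have h3 : Q / (D + Q) ≤ 1 := (div_le_one hDQ).2 (by linarith)
  have h4 : 0 < D / (D + Q) * D := by positivity
  nlinarith

theorem sum_range_dite_eq_sum_Icc {n : ℕ} {j k : Fin n} (hjk : j ≤ k) (g : Fin n → ℝ) :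
    ∑ i ∈ range ((k : ℕ) - j + 1), (if h : (j : ℕ) + i < n then g ⟨j + i, h⟩ else 0) =
      ∑ i ∈ Finset.Icc j k, g i := by
  have hjk' : (j : ℕ) ≤ k := hjk
  symm
  refine sum_bij (fun i _ => (i : ℕ) - j) ?_ ?_ ?_ ?_
  · intro i hi
    simp only [Finset.mem_Icc, Fin.le_def, mem_range] at hi ⊢
    omega
  · intro a ha b hb hab
    simp only [Finset.mem_Icc, Fin.le_def] at ha hb
    exact Fin.ext (by omega)
  · intro b hb
    rw [mem_range] at hb
    refine ⟨⟨j + b, by omega⟩, ?_, by simp⟩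
    simp only [Finset.mem_Icc, Fin.le_def]
    omega
  · intro i hi
    simp only [Finset.mem_Icc, Fin.le_def] at hi
    have : (j : ℕ) + (i - j) = i := by omega
    simp [this]

theorem IsIsotonicProjection.exists_upper {n : ℕ} {x y : Fin n → ℝ} (hx : Monotone x)
    {p : ℝ → ℝ} (hp : IsIsotonicProjection x y p) {c : ℝ} (hc : 0 ≤ c) {j k : Fin n}
    (hjk : (j, k) ∈ idxJ n x) :
    ∃ l : Fin n, (j, l) ∈ idxJ n x ∧
      (∑ i ∈ Finset.Icc j l, y i) / (((l : ℕ) - j + 1 : ℕ) : ℝ) +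
          c / Real.sqrt (((l : ℕ) - j + 1 : ℕ) : ℝ) ≤
        (∑ i ∈ Finset.Icc j k, p (x i)) / (((k : ℕ) - j + 1 : ℕ) : ℝ) +
          c / Real.sqrt (((k : ℕ) - j + 1 : ℕ) : ℝ) := by
  obtain ⟨hle, hj, -⟩ := hjk
  simp only at hle hj
  have hle' : (j : ℕ) ≤ k := hle
  have hjn := j.isLt
  have hkn := k.isLt
  let f : ℕ → ℝ := fun i => if h : (j : ℕ) + i < n then p (x ⟨j + i, h⟩) else 0
  have hf : ∀ a b, a ≤ b → b < n - j → f a ≤ f b := by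
    intro a b hab hb
    have h1 : (j : ℕ) + a < n := by omega
    have h2 : (j : ℕ) + b < n := by omega
    simp only [f, h1, h2, dif_pos]
    exact hp.1 (hx (Fin.mk_le_mk.2 (by omega)))
  obtain ⟨r, hr0, hrM, hbreak, hmin⟩ := exists_ratio_le_of_break hc hf
    (show 0 < (k : ℕ) - j + 1 by omega) (show (k : ℕ) - j + 1 ≤ n - j by omega)
  let l : Fin n := ⟨j + (r - 1), by omega⟩
  have hl : (l : ℕ) = j + (r - 1) := rfl
  have hlr : (l : ℕ) - j + 1 = r := by omega
  have hjl : j ≤ l := Fin.le_def.2 (by omega)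
  have hnext : ∀ i : Fin n, (l : ℕ) + 1 = i → p (x l) < p (x i) := by
    intro i hi
    have h1 : (j : ℕ) + r = i := by omega
    have hin := i.isLt
    have h2 : (j : ℕ) + (r - 1) < n := by omega
    have := hbreak (by omega)
    simp only [f, h1, h2, hin, dif_pos] at this
    exact this
  refine ⟨l, ⟨hjl, hj, fun i hi => ?_⟩, ?_⟩
  · by_contra! hlt
    exact absurd (hp.1 hlt) (not_le.2 (hnext i hi))
  have hsum {m : Fin n} (hm : j ≤ m) :
      ∑ i ∈ range ((m : ℕ) - j + 1), f i = ∑ i ∈ Finset.Icc j m, p (x i) :=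
    sum_range_dite_eq_sum_Icc hm fun i => p (x i)
  rw [hsum hle, ← hlr, hsum hjl] at hmin
  refine le_trans ?_ hmin
  have hout : ∀ i ∉ Finset.Icc j l, x i < x j ∨ l < i := by
    intro i hi
    rw [Finset.mem_Icc, not_and_or, not_le, not_le] at hi
    refine hi.imp_left fun hij => ?_
    have hij' : (i : ℕ) < j := hij
    exact (hx (Fin.le_def.2 (show (i : ℕ) ≤ j - 1 by omega))).trans_lt
      (hj ⟨j - 1, by omega⟩ (by simp; omega))
  refine add_le_add (div_le_div_of_nonneg_right ?_ (Nat.cast_nonneg _)) le_rfl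
  by_cases hln : (l : ℕ) + 1 < n
  · let q : Fin n := ⟨l + 1, hln⟩
    have hq := hnext q rfl
    refine hp.sum_le (a := x j) (B := p (x q)) (sub_pos.2 hq) _ (fun i hi => ?_) fun i hi => ?_
    · rw [Finset.mem_Icc] at hi
      exact ⟨hx hi.1, by linarith [hp.1 (hx hi.2)]⟩
    · exact (hout i hi).imp_right fun h => hp.1 (hx (Fin.le_def.2 (Nat.succ_le_of_lt h)))
  · have hlast : ∀ i : Fin n, i ≤ l := fun i => Fin.le_def.2 (by omega)
    refine hp.sum_le (a := x j) (B := p (x l) + 1) one_pos _ (fun i hi => ?_) fun i hi => ?_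
    · rw [Finset.mem_Icc] at hi
      exact ⟨hx hi.1, by linarith [hp.1 (hx hi.2)]⟩
    · exact (hout i hi).imp_right fun h => absurd (hlast i) (not_le.2 h)

theorem sum_Icc_rev {n : ℕ} (j k : Fin n) (g : Fin n → ℝ) :
    ∑ i ∈ Finset.Icc k.rev j.rev, g i.rev = ∑ i ∈ Finset.Icc j k, g i := by
  refine sum_nbij' Fin.rev Fin.rev ?_ ?_ ?_ ?_ ?_
  · intro i hi
    simp only [Finset.mem_Icc] at hi ⊢
    exact ⟨Fin.le_rev_iff.1 hi.2, Fin.rev_le_iff.1 hi.1⟩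
  · intro i hi
    simp only [Finset.mem_Icc] at hi ⊢
    exact ⟨Fin.rev_le_rev.2 hi.2, Fin.rev_le_rev.2 hi.1⟩
  all_goals simp

theorem rev_mem_idxJ {n : ℕ} {x : Fin n → ℝ} {j k : Fin n} (h : (j, k) ∈ idxJ n x) :
    (k.rev, j.rev) ∈ idxJ n (fun i => -x i.rev) := by
  obtain ⟨h1, h2, h3⟩ := h
  refine ⟨Fin.rev_le_rev.2 h1, fun i hi => ?_, fun i hi => ?_⟩
  · simp only [Fin.rev_rev, neg_lt_neg_iff]
    refine h3 _ ?_
    simp only [Fin.val_rev] at hi ⊢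
    omega
  · simp only [Fin.rev_rev, neg_lt_neg_iff]
    refine h2 _ ?_
    simp only [Fin.val_rev] at hi ⊢
    omega

theorem IsIsotonicProjection.exists_lower {n : ℕ} {x y : Fin n → ℝ} (hx : Monotone x)
    {p : ℝ → ℝ} (hp : IsIsotonicProjection x y p) {c : ℝ} (hc : 0 ≤ c) {j k : Fin n}
    (hjk : (j, k) ∈ idxJ n x) :
    ∃ l : Fin n, (l, k) ∈ idxJ n x ∧
      (∑ i ∈ Finset.Icc j k, p (x i)) / (((k : ℕ) - j + 1 : ℕ) : ℝ) -
          c / Real.sqrt (((k : ℕ) - j + 1 : ℕ) : ℝ) ≤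
        (∑ i ∈ Finset.Icc l k, y i) / (((k : ℕ) - l + 1 : ℕ) : ℝ) -
          c / Real.sqrt (((k : ℕ) - l + 1 : ℕ) : ℝ) := by
  have hx' : Monotone fun i : Fin n => -x i.rev :=
    fun a b hab => neg_le_neg (hx (Fin.rev_le_rev.2 hab))
  obtain ⟨l, hl, hle⟩ := (hp.neg.comp_equiv Fin.revPerm).exists_upper hx' hc (rev_mem_idxJ hjk)
  have hl' : (l.rev, k) ∈ idxJ n x := by
    simpa using rev_mem_idxJ hl
  have hcard (i : Fin n) : ((i.rev : Fin n) : ℕ) - (k.rev : Fin n) = (k : ℕ) - i := by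
    simp only [Fin.val_rev]
    omega
  have hsy := sum_Icc_rev l.rev k y
  rw [Fin.rev_rev] at hsy
  have hl2 := hcard l.rev
  rw [Fin.rev_rev] at hl2
  refine ⟨l.rev, hl', ?_⟩
  simp only [Function.comp_apply, Fin.revPerm_apply, neg_neg, sum_neg_distrib, hcard, hl2, hsy,
    sum_Icc_rev j k fun i => p (x i), neg_div] at hle
  linarith

theorem cpUpper_nonneg (δ : ℝ) (z m : ℕ) : 0 ≤ cpUpper δ z m :=
  Real.sSup_nonneg fun _ h => h.1.1

theorem cpLower_le_one (δ : ℝ) (z m : ℕ) : cpLower δ z m ≤ 1 := by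
  unfold cpLower
  split_ifs
  · exact zero_le_one
  · rcases Set.eq_empty_or_nonempty
      {ξ : ℝ | ξ ∈ Set.Icc (0 : ℝ) 1 ∧ pbin (z - 1) m ξ ≤ 1 - δ} with h | ⟨ξ, h⟩
    · rw [h, Real.sInf_empty]
      exact zero_le_one
    · exact (csInf_le ⟨0, fun _ h => h.1.1⟩ h).trans h.1.2

theorem cpUpper_le {δ : ℝ} (hδ : 0 < δ) (z : ℕ) {m : ℕ} (hm : 0 < m) :
    cpUpper δ z m ≤ z / m + Real.sqrt (Real.log (1 / δ) / (2 * m)) :=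
  Real.sSup_le (fun _ h => le_of_le_pbin hm hδ h.1.1 h.1.2 h.2) (by positivity)

theorem le_cpLower {δ : ℝ} (hδ0 : 0 < δ) (hδ1 : δ ≤ 1) {z m : ℕ} (hm : 0 < m) (hz : z ≤ m) :
    z / m - Real.sqrt (Real.log (1 / δ) / (2 * m)) ≤ cpLower δ z m := by
  unfold cpLower
  split_ifs with h0
  · rw [h0, Nat.cast_zero, zero_div, zero_sub, neg_nonpos]
    exact Real.sqrt_nonneg _
  · obtain ⟨w, rfl⟩ : ∃ w, z = w + 1 := ⟨z - 1, by omega⟩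
    rw [Nat.add_sub_cancel]
    refine le_csInf ⟨1, ⟨zero_le_one, le_rfl⟩, ?_⟩ fun ξ hξ => ?_
    · rw [pbin, sum_eq_zero fun t ht => ?_]
      · linarith
      · rw [mem_range] at ht
        rw [sub_self, zero_pow (by omega), mul_zero]
    · have h := le_of_le_pbin hm hδ0 (z := m - (w + 1)) (sub_nonneg.2 hξ.1.2)
        (sub_le_self _ hξ.1.1) (by rw [pbin_one_sub hz]; linarith [hξ.2])
      have hm' : (m : ℝ) ≠ 0 := by positivity
      rw [Nat.cast_sub hz, sub_div, div_self hm'] at h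
      linarith

theorem sqrt_div_two_mul {a : ℝ} (ha : 0 ≤ a) (m : ℝ) :
    Real.sqrt (a / (2 * m)) = Real.sqrt (a / 2) / Real.sqrt m := by
  rw [← div_div, Real.sqrt_div (by positivity)]

theorem deltaN_pos_le {n : ℕ} (x : Fin n → ℝ) (j : Fin n) {α : ℝ} (hα : α ∈ Set.Ioo (0 : ℝ) 1) :
    0 < deltaN n x α ∧ deltaN n x α ≤ 1 := by
  have hN : (1 : ℝ) ≤ distinctN n x := by
    exact_mod_cast card_pos.2 ⟨x j, mem_image_of_mem x (mem_univ j)⟩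
  have hN2 : (1 : ℝ) ≤ (distinctN n x : ℝ) ^ 2 + distinctN n x := by nlinarith
  have := hα.1
  exact ⟨div_pos hα.1 (by linarith), div_le_one_of_le₀ (hα.2.le.trans hN2) (by linarith)⟩

theorem Uraw_le_Uyb {n : ℕ} {x : Fin n → ℝ} (hx : Monotone x) {Y : Fin n → ℕ} {p : ℝ → ℝ}
    (hp : IsIsotonicProjection x (fun i => (Y i : ℝ)) p) {α : ℝ} (hα : α ∈ Set.Ioo (0 : ℝ) 1)
    (t : ℝ) : Uraw n x Y α t ≤ Uyb n x p α t := by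
  have hbdd : BddBelow (insert (1 : ℝ) {u : ℝ | ∃ jk ∈ idxJ n x, t ≤ x jk.1 ∧
      u = cpUpper (deltaN n x α) (∑ i ∈ Finset.Icc jk.1 jk.2, Y i)
        ((jk.2 : ℕ) - (jk.1 : ℕ) + 1)}) := by
    refine ⟨0, ?_⟩
    rintro _ (rfl | ⟨jk, -, -, rfl⟩)
    exacts [zero_le_one, cpUpper_nonneg _ _ _]
  refine le_csInf (Set.insert_nonempty _ _) ?_
  rintro _ (rfl | ⟨⟨j, k⟩, hjk, ht, rfl⟩)
  · exact csInf_le hbdd (Set.mem_insert _ _)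
  obtain ⟨hδ0, hδ1⟩ := deltaN_pos_le x j hα
  have hlog : 0 ≤ Real.log (1 / deltaN n x α) := Real.log_nonneg (one_le_one_div hδ0 hδ1)
  obtain ⟨l, hl, hle⟩ :=
    hp.exists_upper hx (Real.sqrt_nonneg (Real.log (1 / deltaN n x α) / 2)) hjk
  refine (csInf_le hbdd (Set.mem_insert_of_mem _ ⟨(j, l), hl, ht, rfl⟩)).trans ?_
  refine (cpUpper_le hδ0 _ (Nat.succ_pos _)).trans ?_
  rw [← one_div_div α, ← deltaN, sqrt_div_two_mul hlog, sqrt_div_two_mul hlog]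
  push_cast at hle ⊢
  exact hle

theorem Lyb_le_Lraw {n : ℕ} {x : Fin n → ℝ} (hx : Monotone x) {Y : Fin n → ℕ}
    (hY : ∀ i, Y i ≤ 1) {p : ℝ → ℝ} (hp : IsIsotonicProjection x (fun i => (Y i : ℝ)) p) {α : ℝ}
    (hα : α ∈ Set.Ioo (0 : ℝ) 1) (t : ℝ) : Lyb n x p α t ≤ Lraw n x Y α t := by
  have hbdd : BddAbove (insert (0 : ℝ) {u : ℝ | ∃ jk ∈ idxJ n x, x jk.2 ≤ t ∧
      u = cpLower (deltaN n x α) (∑ i ∈ Finset.Icc jk.1 jk.2, Y i)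
        ((jk.2 : ℕ) - (jk.1 : ℕ) + 1)}) := by
    refine ⟨1, ?_⟩
    rintro _ (rfl | ⟨jk, -, -, rfl⟩)
    exacts [zero_le_one, cpLower_le_one _ _ _]
  refine csSup_le (Set.insert_nonempty _ _) ?_
  rintro _ (rfl | ⟨⟨j, k⟩, hjk, ht, rfl⟩)
  · exact le_csSup hbdd (Set.mem_insert _ _)
  obtain ⟨hδ0, hδ1⟩ := deltaN_pos_le x j hα
  have hlog : 0 ≤ Real.log (1 / deltaN n x α) := Real.log_nonneg (one_le_one_div hδ0 hδ1)
  obtain ⟨l, hl, hle⟩ :=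
    hp.exists_lower hx (Real.sqrt_nonneg (Real.log (1 / deltaN n x α) / 2)) hjk
  refine le_trans ?_ (le_csSup hbdd (Set.mem_insert_of_mem _ ⟨(l, k), hl, ht, rfl⟩))
  have hlk : (l : ℕ) ≤ k := hl.1
  have hcard : ∑ i ∈ Finset.Icc l k, Y i ≤ (k : ℕ) - l + 1 := by
    have := sum_le_card_nsmul (Finset.Icc l k) Y 1 fun i _ => hY i
    rw [Fin.card_Icc, smul_eq_mul, mul_one] at this
    exact this.trans (by omega)
  refine le_trans ?_ (le_cpLower hδ0 hδ1 (Nat.succ_pos _) hcard)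
  rw [← one_div_div α, ← deltaN, sqrt_div_two_mul hlog, sqrt_div_two_mul hlog]
  push_cast at hle ⊢
  exact hle

theorem le_Uyb {n : ℕ} {x : Fin n → ℝ} (hx : Monotone x) {p : ℝ → ℝ} (hp : Monotone p)
    (hp1 : ∀ s, p s ≤ 1) (α t : ℝ) : p t ≤ Uyb n x p α t := by
  refine le_csInf (Set.insert_nonempty _ _) ?_
  rintro _ (rfl | ⟨⟨j, k⟩, hjk, ht, rfl⟩)
  · exact hp1 t
  refine le_add_of_le_of_nonneg ?_ (Real.sqrt_nonneg _)
  have hjk' : (j : ℕ) ≤ k := hjk.1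
  have := card_nsmul_le_sum (Finset.Icc j k) (fun i => p (x i)) (p t) fun i hi =>
    hp (ht.trans (hx (Finset.mem_Icc.1 hi).1))
  rw [Fin.card_Icc, nsmul_eq_mul, show (k : ℕ) + 1 - j = k - j + 1 by omega] at this
  rw [le_div_iff₀ (by positivity), mul_comm]
  exact this

theorem Lyb_le {n : ℕ} {x : Fin n → ℝ} (hx : Monotone x) {p : ℝ → ℝ} (hp : Monotone p)
    (hp0 : ∀ s, 0 ≤ p s) (α t : ℝ) : Lyb n x p α t ≤ p t := by
  refine csSup_le (Set.insert_nonempty _ _) ?_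
  rintro _ (rfl | ⟨⟨j, k⟩, hjk, ht, rfl⟩)
  · exact hp0 t
  refine (sub_le_self _ (Real.sqrt_nonneg _)).trans ?_
  have hjk' : (j : ℕ) ≤ k := hjk.1
  have := sum_le_card_nsmul (Finset.Icc j k) (fun i => p (x i)) (p t) fun i hi =>
    hp ((hx (Finset.mem_Icc.1 hi).2).trans ht)
  rw [Fin.card_Icc, nsmul_eq_mul, show (k : ℕ) + 1 - j = k - j + 1 by omega] at this
  rw [div_le_iff₀ (by positivity), mul_comm]
  exact this


/-- **Theorem 2 (nestedness of the three bands).**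
For every `α ∈ (0,1)` and every data vector `(Y_1,…,Y_n) ∈ {0,1}^n`:
`L^{α,YB} ≤ L^{α,nc} ≤ L^{α,raw}` and `U^{α,raw} ≤ U^{α,nc} ≤ U^{α,YB}` on `ℝ`,
where `L^{α,nc} = min(L^{α,raw}, p̂)` and `U^{α,nc} = max(U^{α,raw}, p̂)`. -/
theorem bands_nested
    (n : ℕ) (x : Fin n → ℝ) (hx : Monotone x)
    (Y : Fin n → ℕ) (hY01 : ∀ i, Y i ≤ 1)
    (phat : ℝ → ℝ) (hphat : IsIsoFit01 n x (fun i => (Y i : ℝ)) phat)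
    (α : ℝ) (hα : α ∈ Set.Ioo (0 : ℝ) 1) (t : ℝ) :
    (Lyb n x phat α t ≤ min (Lraw n x Y α t) (phat t) ∧
      min (Lraw n x Y α t) (phat t) ≤ Lraw n x Y α t) ∧
    (Uraw n x Y α t ≤ max (Uraw n x Y α t) (phat t) ∧
      max (Uraw n x Y α t) (phat t) ≤ Uyb n x phat α t) := by
  have hp := hphat.isIsotonicProjection fun i => ⟨Nat.cast_nonneg _, by exact_mod_cast hY01 i⟩
  exact ⟨⟨le_min (Lyb_le_Lraw hx hY01 hp hα t) (Lyb_le hx hphat.1 (fun s => (hphat.2.1 s).1) α t),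
    min_le_left _ _⟩, le_max_left _ _,
    max_le (Uraw_le_Uyb hx hp hα t) (le_Uyb hx hphat.1 (fun s => (hphat.2.1 s).2) α t)⟩
end

section
/- Let x_1 ≤ … ≤ x_n be real numbers, Y_1, …, Y_n ∈ {0,1}, and let p̂ be an isotonic function minimizing Σ_{i=1}^n {Y_i − p̂(x_i)}² over isotonic functions. Then the cardinality of the set {p̂(x_i) : i = 1, …, n} of fitted values is smaller than 3 n^{2/3}. -/
open Finset

/-- An isotonic (nondecreasing) function `phat : ℝ → ℝ` minimizing
`Σ (Y_i - h(x_i))²` over all isotonic functions `h : ℝ → ℝ`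
(the isotonic least-squares fit). -/
def IsIsoFit (n : ℕ) (x : Fin n → ℝ) (Y : Fin n → ℝ) (phat : ℝ → ℝ) : Prop :=
  Monotone phat ∧ ∀ h : ℝ → ℝ, Monotone h →
    ∑ i, (Y i - phat (x i)) ^ 2 ≤ ∑ i, (Y i - h (x i)) ^ 2

/-- The map that is constantly `v + ε` within distance `δ` of `v`, and the identity elsewhere,
is monotone as soon as `|ε| ≤ δ`. -/
theorem monotone_ite_abs_sub_lt {v δ ε : ℝ} (hε : |ε| ≤ δ) :
    Monotone (fun u : ℝ => if |u - v| < δ then v + ε else u) := by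
  intro a b hab
  obtain ⟨h1, h2⟩ := abs_le.mp hε
  simp only [abs_lt]
  split_ifs with ha hb hb
  · exact le_rfl
  · by_contra! h
    exact hb ⟨by linarith [ha.1], by linarith⟩
  · by_contra! h
    exact ha ⟨by linarith, by linarith [hb.2]⟩
  · exact hab

/-- In a finite set of reals, every point is isolated. -/
theorem exists_pos_forall_mem_abs_sub_lt (V : Finset ℝ) (v : ℝ) :
    ∃ δ > 0, ∀ u ∈ V, |u - v| < δ → u = v := by
  induction V using Finset.induction_on with
  | empty => exact ⟨1, one_pos, by simp⟩
  | insert a V _ ih =>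
    obtain ⟨δ, hδ, h⟩ := ih
    by_cases hav : a = v
    · refine ⟨δ, hδ, fun u hu hlt => ?_⟩
      rcases Finset.mem_insert.mp hu with rfl | hu
      exacts [hav, h u hu hlt]
    · refine ⟨min δ |a - v|, lt_min hδ (abs_pos.mpr (sub_ne_zero.mpr hav)), fun u hu hlt => ?_⟩
      rcases Finset.mem_insert.mp hu with rfl | hu
      · exact absurd (hlt.trans_le (min_le_right _ _)) (lt_irrefl _)
      · exact h u hu (hlt.trans_le (min_le_left _ _))

/-- The residuals of an isotonic least-squares fit sum to zero over each level set. -/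
theorem IsIsoFit.sum_residual_eq_zero {n : ℕ} {x Y : Fin n → ℝ} {phat : ℝ → ℝ}
    (h : IsIsoFit n x Y phat) (v : ℝ) :
    ∑ i with phat (x i) = v, (Y i - v) = 0 := by
  obtain ⟨δ, hδ, hiso⟩ :=
    exists_pos_forall_mem_abs_sub_lt (Finset.univ.image fun i => phat (x i)) v
  set S : Finset (Fin n) := Finset.univ.filter fun i => phat (x i) = v
  set A := ∑ i ∈ S, (Y i - v)
  have key : ∀ ε : ℝ, |ε| ≤ δ → 2 * ε * A ≤ S.card * ε ^ 2 := by
    intro ε hε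
    have hle := h.2 _ ((monotone_ite_abs_sub_lt (v := v) hε).comp h.1)
    have hterm : ∀ i, (Y i - (if |phat (x i) - v| < δ then v + ε else phat (x i))) ^ 2
        = (Y i - phat (x i)) ^ 2
          + if phat (x i) = v then ε ^ 2 - 2 * ε * (Y i - v) else 0 := by
      intro i
      by_cases hi : phat (x i) = v
      · simp only [hi, sub_self, abs_zero, hδ, if_true]
        ring
      · have hn : ¬ |phat (x i) - v| < δ := fun hlt =>
          hi (hiso _ (Finset.mem_image_of_mem _ (Finset.mem_univ i)) hlt)
        simp [hi, hn]
    simp only [Function.comp_apply, hterm] at hle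
    rw [Finset.sum_add_distrib, ← Finset.sum_filter, Finset.sum_sub_distrib, Finset.sum_const,
      ← Finset.mul_sum, nsmul_eq_mul] at hle
    linarith
  have hcard : (0 : ℝ) ≤ S.card := Nat.cast_nonneg _
  by_contra hA
  have hApos : 0 < |A| := abs_pos.mpr hA
  have hden : 0 < |A| + S.card * δ := by positivity
  have hc : 0 < δ / (|A| + S.card * δ) := by positivity
  have hkey := key (A * (δ / (|A| + S.card * δ))) (by
    rw [abs_mul, abs_of_pos hc, ← mul_div_assoc, div_le_iff₀ hden]
    nlinarith [mul_nonneg hcard (mul_pos hδ hδ).le])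
  have hcS : S.card * (δ / (|A| + S.card * δ)) ≤ 1 := by
    rw [← mul_div_assoc, div_le_one hden]
    linarith
  have hpos : 0 < A ^ 2 * (δ / (|A| + S.card * δ)) := by positivity
  nlinarith [mul_le_mul_of_nonneg_left hcS hpos.le]

/-- There are at most `1 + k (k + 1) / 2` fractions in `[0, 1]` with denominator at most `k`. -/
theorem card_fractions_le (V : Finset ℝ) (m s : ℝ → ℕ) (k : ℕ) (hm : ∀ v ∈ V, 0 < m v)
    (hmk : ∀ v ∈ V, m v ≤ k) (hs : ∀ v ∈ V, s v ≤ m v) (hv : ∀ v ∈ V, v * m v = s v) :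
    (V.card : ℝ) ≤ 1 + k * (k + 1) / 2 := by
  have hsub : V ⊆ insert 0 (((Finset.range (k + 1)).sigma fun a => Finset.Icc 1 a).image
      fun p : (_ : ℕ) × ℕ => (p.2 / p.1 : ℝ)) := by
    intro v hvV
    have hmv : (m v : ℝ) ≠ 0 := by exact_mod_cast (hm v hvV).ne'
    have hveq : (s v / m v : ℝ) = v := by rw [← hv v hvV]; field_simp
    rcases Nat.eq_zero_or_pos (s v) with h0 | h0
    · rw [← hveq, h0]; simp
    · refine Finset.mem_insert_of_mem (Finset.mem_image.mpr ⟨⟨m v, s v⟩, ?_, hveq⟩)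
      simp only [Finset.mem_sigma, Finset.mem_range, Finset.mem_Icc]
      exact ⟨Nat.lt_succ_of_le (hmk v hvV), h0, hs v hvV⟩
  have hcard : V.card ≤ ∑ a ∈ Finset.range (k + 1), a + 1 := by
    refine (Finset.card_le_card hsub).trans ((Finset.card_insert_le _ _).trans ?_)
    gcongr
    refine Finset.card_image_le.trans ?_
    simp [Finset.card_sigma]
  have hgauss : ((∑ a ∈ Finset.range (k + 1), a : ℕ) : ℝ) * 2 = (k + 1) * k := by
    exact_mod_cast Finset.sum_range_id_mul_two (k + 1)
  have : (V.card : ℝ) ≤ ((∑ a ∈ Finset.range (k + 1), a : ℕ) : ℝ) + 1 := by exact_mod_cast hcard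
  linarith

/-- A finite set of distinct fractions in `[0, 1]` whose denominators sum to at most `n`
has fewer than `3 n ^ (2 / 3)` elements. -/
theorem card_lt_of_sum_denominators_le {n : ℕ} (hn : 0 < n) (V : Finset ℝ) (m s : ℝ → ℕ)
    (hm : ∀ v ∈ V, 0 < m v) (hs : ∀ v ∈ V, s v ≤ m v) (hv : ∀ v ∈ V, v * m v = s v)
    (hsum : ∑ v ∈ V, m v ≤ n) :
    (V.card : ℝ) < 3 * (n : ℝ) ^ ((2 : ℝ) / 3) := by
  set t : ℝ := (n : ℝ) ^ ((1 : ℝ) / 3) with ht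
  have hn1 : (1 : ℝ) ≤ n := by exact_mod_cast hn
  have ht1 : 1 ≤ t := Real.one_le_rpow hn1 (by norm_num)
  have ht2 : (n : ℝ) ^ ((2 : ℝ) / 3) = t ^ 2 := by
    rw [ht, ← Real.rpow_natCast, ← Real.rpow_mul (by positivity)]; norm_num
  have ht3 : (n : ℝ) = t ^ 3 := by
    rw [ht, ← Real.rpow_natCast, ← Real.rpow_mul (by positivity)]; norm_num
  set k := ⌊t⌋₊
  have hkt : (k : ℝ) ≤ t := Nat.floor_le (by linarith)
  have htk : t < k + 1 := Nat.lt_floor_add_one t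
  have hsmall := card_fractions_le (V.filter fun v => m v ≤ k) m s k
    (fun v h => hm v (Finset.mem_filter.mp h).1) (fun v h => (Finset.mem_filter.mp h).2)
    (fun v h => hs v (Finset.mem_filter.mp h).1) (fun v h => hv v (Finset.mem_filter.mp h).1)
  have hlarge : ((V.filter fun v => ¬ m v ≤ k).card : ℝ) * (k + 1) ≤ t ^ 3 := by
    rw [← ht3]
    have hle : (V.filter fun v => ¬ m v ≤ k).card * (k + 1) ≤ n := by
      refine le_trans ?_ ((Finset.sum_le_sum_of_subset (Finset.filter_subset (fun v => ¬ m v ≤ k) V)).trans hsum)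
      rw [← smul_eq_mul]
      refine Finset.card_nsmul_le_sum _ _ _ fun v h => ?_
      have := (Finset.mem_filter.mp h).2
      omega
    exact_mod_cast hle
  have hlarge' : ((V.filter fun v => ¬ m v ≤ k).card : ℝ) < t ^ 2 := by
    refine lt_of_mul_lt_mul_right (hlarge.trans_lt ?_) (show (0 : ℝ) ≤ k + 1 by positivity)
    calc t ^ 3 = t ^ 2 * t := by ring
      _ < t ^ 2 * (k + 1) := by gcongr
  have hsplit : ((V.filter fun v => m v ≤ k).card : ℝ) + (V.filter fun v => ¬ m v ≤ k).card
      = V.card := by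
    exact_mod_cast Finset.card_filter_add_card_filter_not (s := V) (fun v => m v ≤ k)
  rw [ht2]
  have hkk : (k : ℝ) * (k + 1) ≤ t * (t + 1) := by gcongr
  nlinarith

/-- **Lemma 1.** For binary data `Y_1, …, Y_n ∈ {0,1}` with covariates
`x_1 ≤ … ≤ x_n`, the number of distinct fitted values `{p̂(x_i) : i = 1,…,n}` of the
isotonic least-squares fit is smaller than `3 n^{2/3}`. -/
theorem card_fitted_values_lt
    (n : ℕ) (hn : 0 < n) (x : Fin n → ℝ) (hx : Monotone x)
    (Y : Fin n → ℕ) (hY01 : ∀ i, Y i ≤ 1)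
    (phat : ℝ → ℝ) (hphat : IsIsoFit n x (fun i => (Y i : ℝ)) phat) :
    ((Finset.univ.image (fun i => phat (x i))).card : ℝ) < 3 * (n : ℝ) ^ ((2 : ℝ) / 3) := by
  refine card_lt_of_sum_denominators_le hn _
    (fun v => (Finset.univ.filter fun i => phat (x i) = v).card)
    (fun v => ∑ i with phat (x i) = v, Y i) ?_ ?_ ?_ ?_
  · intro v hv
    obtain ⟨i, -, hi⟩ := Finset.mem_image.mp hv
    exact Finset.card_pos.mpr ⟨i, by simpa using hi⟩
  · intro v _
    simpa using Finset.sum_le_card_nsmul _ _ 1 fun i _ => hY01 i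
  · intro v _
    have h := hphat.sum_residual_eq_zero v
    rw [Finset.sum_sub_distrib, Finset.sum_const, nsmul_eq_mul] at h
    push_cast
    linarith
  · rw [← Finset.card_eq_sum_card_image]
    simp
end

section
/- For all integers m ≥ 1, z ∈ {0,1,…,m} and δ ∈ (0,1), with q̂ = z/m: u^δ(z,m) ≤ max{ ξ ∈ [q̂,1] : K(q̂,ξ) ≤ log(1/δ)/m } ≤ q̂ + sqrt( log(1/δ)/(2m) ), and ℓ^δ(z,m) ≥ min{ ξ ∈ [0,q̂] : K(q̂,ξ) ≤ log(1/δ)/m } ≥ q̂ − sqrt( log(1/δ)/(2m) ). -/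
open MeasureTheory Finset

/-- `K(r, q) = r log(r/q) + (1 - r) log{(1 - r)/(1 - q)}` (convention `0 log 0 := 0`). -/
noncomputable def Kfun (r q : ℝ) : ℝ :=
  r * Real.log (r / q) + (1 - r) * Real.log ((1 - r) / (1 - q))

/-- The set `{ξ ∈ [q̂, 1] : K(q̂, ξ) ≤ γ}`; the side condition `ξ ∈ (0,1) ∨ ξ = q̂`
implements the convention that `K(q̂, ξ) = +∞` when `ξ` is an endpoint of `[0,1]`
different from `q̂` (in particular when `ξ ∈ {0,1}` and `q̂ ∈ (0,1)`). -/
def upKraw (qhat γ : ℝ) : Set ℝ :=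
  {ξ : ℝ | ξ ∈ Set.Icc qhat 1 ∧ (ξ ∈ Set.Ioo (0 : ℝ) 1 ∨ ξ = qhat) ∧ Kfun qhat ξ ≤ γ}

/-- The set `{ξ ∈ [0, q̂] : K(q̂, ξ) ≤ γ}`; see `upKraw` for the side condition. -/
def loKraw (qhat γ : ℝ) : Set ℝ :=
  {ξ : ℝ | ξ ∈ Set.Icc 0 qhat ∧ (ξ ∈ Set.Ioo (0 : ℝ) 1 ∨ ξ = qhat) ∧ Kfun qhat ξ ≤ γ}

theorem Kfun_eq_sub_log {q ξ : ℝ} (h0 : 0 < ξ) (h1 : ξ < 1) :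
    Kfun q ξ = q * Real.log q + (1 - q) * Real.log (1 - q)
      - (q * Real.log ξ + (1 - q) * Real.log (1 - ξ)) := by
  have a : q * Real.log (q / ξ) = q * Real.log q - q * Real.log ξ := by
    rcases eq_or_ne q 0 with rfl | hq
    · simp
    · rw [Real.log_div hq h0.ne', mul_sub]
  have b : (1 - q) * Real.log ((1 - q) / (1 - ξ))
      = (1 - q) * Real.log (1 - q) - (1 - q) * Real.log (1 - ξ) := by
    rcases eq_or_ne (1 - q) 0 with hq | hq
    · simp [hq]
    · rw [Real.log_div hq (sub_pos.2 h1).ne', mul_sub]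
  rw [Kfun, a, b]
  ring

theorem Kfun_self (q : ℝ) : Kfun q q = 0 := by
  rw [Kfun]
  rcases eq_or_ne q 0 with rfl | hq
  · simp
  rcases eq_or_ne (1 - q) 0 with h | h
  · simp [h, hq]
  · simp [div_self hq, div_self h]

theorem Kfun_one_sub (q ξ : ℝ) : Kfun (1 - q) (1 - ξ) = Kfun q ξ := by
  simp only [Kfun, sub_sub_cancel]
  ring

theorem self_mem_upKraw {q γ : ℝ} (hq1 : q ≤ 1) (hγ : 0 ≤ γ) : q ∈ upKraw q γ :=
  ⟨⟨le_rfl, hq1⟩, Or.inr rfl, by rwa [Kfun_self]⟩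

theorem one_sub_mem_upKraw_iff {q γ ξ : ℝ} : 1 - ξ ∈ upKraw (1 - q) γ ↔ ξ ∈ loKraw q γ := by
  simp only [upKraw, loKraw, Set.mem_ofPred_eq, Kfun_one_sub, Set.mem_Icc, Set.mem_Ioo]
  constructor
  · rintro ⟨⟨a, b⟩, c, d⟩
    refine ⟨⟨by linarith, by linarith⟩, c.imp (fun h => ⟨by linarith, by linarith⟩)
      (fun h => by linarith), d⟩
  · rintro ⟨⟨a, b⟩, c, d⟩
    refine ⟨⟨by linarith, by linarith⟩, c.imp (fun h => ⟨by linarith, by linarith⟩)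
      (fun h => by linarith), d⟩

/-- Pinsker's inequality for Bernoulli distributions, on one side of the diagonal. -/
theorem two_mul_sq_sub_le_Kfun {q ξ : ℝ} (hq : 0 ≤ q) (hqξ : q < ξ) (hξ : ξ < 1) :
    2 * (ξ - q) ^ 2 ≤ Kfun q ξ := by
  have hmono : MonotoneOn
      (fun x : ℝ => -(q * Real.log x + (1 - q) * Real.log (1 - x)) - 2 * (x - q) ^ 2)
      (Set.Ico q 1) := by
    refine monotoneOn_of_hasDerivWithinAt_nonneg (convex_Ico q 1)
      (f' := fun x => -(q * x⁻¹ + (1 - q) * (-1 / (1 - x))) - 2 * (2 * (x - q))) ?_ ?_ ?_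
    · have h1 : ContinuousOn (fun x : ℝ => q * Real.log x) (Set.Ico q 1) := by
        rcases hq.eq_or_lt with rfl | hq
        · simpa using continuousOn_const
        · exact continuousOn_const.mul
            (continuousOn_id.log fun x hx => (hq.trans_le hx.1).ne')
      have h2 : ContinuousOn (fun x : ℝ => Real.log (1 - x)) (Set.Ico q 1) :=
        (continuousOn_const.sub continuousOn_id).log fun x hx => (sub_pos.2 hx.2).ne'
      fun_prop
    · intro x hx
      rw [interior_Ico] at hx
      have hx0 : x ≠ 0 := (hq.trans_lt hx.1).ne'
      have hx1 : 1 - x ≠ 0 := (sub_pos.2 hx.2).ne'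
      have d1 := (Real.hasDerivAt_log hx0).const_mul q
      have d2 := (((hasDerivAt_id x).const_sub 1).log hx1).const_mul (1 - q)
      have d3 := (((hasDerivAt_id x).sub_const q).pow 2).const_mul 2
      refine (((d1.add d2).neg.sub d3).congr_deriv ?_).hasDerivWithinAt
      simp
    · intro x hx
      rw [interior_Ico] at hx
      have hx0 : 0 < x := hq.trans_lt hx.1
      have hx1 : 0 < 1 - x := sub_pos.2 hx.2
      have e : -(q * x⁻¹ + (1 - q) * (-1 / (1 - x))) - 2 * (2 * (x - q))
          = (x - q) * (1 - 2 * x) ^ 2 / (x * (1 - x)) := by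
        field_simp
        ring
      rw [e]
      have := sub_pos.2 hx.1
      positivity
  have h := hmono ⟨le_rfl, hqξ.trans hξ⟩ ⟨hqξ.le, hξ⟩ hqξ.le
  rw [Kfun_eq_sub_log (hq.trans_lt hqξ) hξ]
  simp only [sub_self] at h
  linarith

theorem le_add_sqrt_of_mem_upKraw {q γ ξ : ℝ} (hq : 0 ≤ q) (h : ξ ∈ upKraw q γ) :
    ξ ≤ q + √(γ / 2) := by
  obtain ⟨⟨hqξ, -⟩, h01, hK⟩ := h
  rcases hqξ.eq_or_lt with rfl | hlt
  · linarith [Real.sqrt_nonneg (γ / 2)]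
  · have hξ : ξ < 1 := (h01.resolve_right hlt.ne').2
    have := two_mul_sq_sub_le_Kfun hq hlt hξ
    have := Real.le_sqrt_of_sq_le (x := ξ - q) (y := γ / 2) (by linarith)
    linarith

theorem sum_binomial_terms (m : ℕ) (ξ : ℝ) :
    ∑ t ∈ range (m + 1), (m.choose t : ℝ) * ξ ^ t * (1 - ξ) ^ (m - t) = 1 := by
  have h := add_pow ξ (1 - ξ) m
  rw [add_sub_cancel, one_pow] at h
  exact (sum_congr rfl fun t _ => by ring).trans h.symm

theorem pbin_le_one {z m : ℕ} (hz : z ≤ m) {ξ : ℝ} (h0 : 0 ≤ ξ) (h1 : ξ ≤ 1) :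
    pbin z m ξ ≤ 1 := by
  have := sub_nonneg.2 h1
  refine le_trans ?_ (sum_binomial_terms m ξ).le
  exact sum_le_sum_of_subset_of_nonneg (range_mono (by omega)) fun t _ _ => by positivity

theorem pbin_one {z m : ℕ} (hz : z < m) : pbin z m 1 = 0 :=
  sum_eq_zero fun t ht => by
    have : m - t ≠ 0 := by have := mem_range.1 ht; omega
    simp [this]

theorem pbin_add_pbin_one_sub {z m : ℕ} (hz0 : z ≠ 0) (hz : z ≤ m) (ξ : ℝ) :
    pbin (z - 1) m ξ + pbin (m - z) m (1 - ξ) = 1 := by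
  refine Eq.trans ?_ (sum_binomial_terms m ξ)
  rw [pbin, pbin, Nat.sub_add_cancel (Nat.pos_of_ne_zero hz0),
    ← sum_range_add_sum_Ico _ (show z ≤ m + 1 by omega), add_right_inj,
    sum_Ico_eq_sum_range, ← sum_range_reflect, show m + 1 - z = m - z + 1 by omega]
  refine sum_congr rfl fun t ht => ?_
  have ht : t ≤ m - z := Nat.lt_succ_iff.1 (mem_range.1 ht)
  have e : m - z + 1 - 1 - t = m - (z + t) := by omega
  have e' : m - (m - (z + t)) = z + t := by omega
  rw [e, e', Nat.choose_symm (by omega), sub_sub_cancel]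
  ring

/-- The Chernoff bound for the binomial lower tail, in product form. -/
theorem pow_mul_pow_mul_pbin_le {z m : ℕ} (hz : z ≤ m) {q ξ : ℝ} (hq : 0 ≤ q) (hqξ : q ≤ ξ)
    (hξ : ξ ≤ 1) :
    q ^ z * (1 - q) ^ (m - z) * pbin z m ξ ≤ ξ ^ z * (1 - ξ) ^ (m - z) := by
  have hξ0 : 0 ≤ ξ := hq.trans hqξ
  have hξ1 : 0 ≤ 1 - ξ := sub_nonneg.2 hξ
  have hq1 : 0 ≤ 1 - q := by linarith
  calc q ^ z * (1 - q) ^ (m - z) * pbin z m ξ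
      ≤ ξ ^ z * (1 - ξ) ^ (m - z) * pbin z m q := by
        rw [pbin, pbin, mul_sum, mul_sum]
        refine sum_le_sum fun t ht => ?_
        obtain ⟨s, rfl⟩ := Nat.exists_eq_add_of_le (Nat.lt_succ_iff.1 (mem_range.1 ht))
        rw [show m - t = m - (t + s) + s by omega]
        have key : q ^ s * (1 - ξ) ^ s ≤ ξ ^ s * (1 - q) ^ s := by
          rw [← mul_pow, ← mul_pow]
          exact pow_le_pow_left₀ (by positivity) (by linarith) s
        calc _ = m.choose t * (q ^ t * ξ ^ t * (1 - q) ^ (m - (t + s))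
                * (1 - ξ) ^ (m - (t + s))) * (q ^ s * (1 - ξ) ^ s) := by ring
          _ ≤ m.choose t * (q ^ t * ξ ^ t * (1 - q) ^ (m - (t + s))
                * (1 - ξ) ^ (m - (t + s))) * (ξ ^ s * (1 - q) ^ s) := by gcongr
          _ = _ := by ring
    _ ≤ _ := mul_le_of_le_one_right (by positivity) (pbin_le_one hz hq (hqξ.trans hξ))

theorem le_or_mem_upKraw_of_le_pbin {z m : ℕ} (hm : 0 < m) (hz : z ≤ m) {δ ξ : ℝ} (hδ : 0 < δ)
    (hξ : ξ ≤ 1) (h : δ ≤ pbin z m ξ) :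
    ξ ≤ (z : ℝ) / m ∨ ξ ∈ upKraw ((z : ℝ) / m) (Real.log (1 / δ) / m) := by
  rw [or_iff_not_imp_left, not_le]
  intro hlt
  have hm' : (0 : ℝ) < m := Nat.cast_pos.2 hm
  set q : ℝ := (z : ℝ) / m with hqdef
  have hq : 0 ≤ q := by positivity
  have hq1 : 0 < 1 - q := by linarith
  have hzm : z < m := by
    have : q < 1 := by linarith
    rw [hqdef, div_lt_one hm'] at this
    exact_mod_cast this
  have hξ1 : ξ < 1 := hξ.lt_of_ne fun e => by
    rw [e, pbin_one hzm] at h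
    linarith
  have hξ0 : 0 < ξ := hq.trans_lt hlt
  refine ⟨⟨hlt.le, hξ⟩, Or.inl ⟨hξ0, hξ1⟩, ?_⟩
  have hqz : 0 < q ^ z := by
    rcases Nat.eq_zero_or_pos z with rfl | hz0
    · simp
    · positivity
  have hle : q ^ z * (1 - q) ^ (m - z) * δ ≤ ξ ^ z * (1 - ξ) ^ (m - z) :=
    (mul_le_mul_of_nonneg_left h (by positivity)).trans
      (pow_mul_pow_mul_pbin_le hz hq hlt.le hξ)
  have hξ1' : 0 < 1 - ξ := sub_pos.2 hξ1
  have hlog := Real.log_le_log (by positivity) hle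
  rw [Real.log_mul (by positivity) hδ.ne', Real.log_mul hqz.ne' (by positivity),
    Real.log_mul (by positivity) (by positivity)] at hlog
  simp only [Real.log_pow] at hlog
  have e1 : (z : ℝ) = m * q := by rw [hqdef]; field_simp
  have e2 : ((m - z : ℕ) : ℝ) = m * (1 - q) := by rw [Nat.cast_sub hz, e1]; ring
  rw [e2, e1] at hlog
  rw [le_div_iff₀ hm', Kfun_eq_sub_log hξ0 hξ1, one_div, Real.log_inv]
  linarith

/-- **Corollary B1.** For integers `m ≥ 1`, `z ∈ {0,…,m}` and `δ ∈ (0,1)`, with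
`q̂ = z/m`:
`u^δ(z,m) ≤ max{ξ ∈ [q̂,1] : K(q̂,ξ) ≤ log(1/δ)/m} ≤ q̂ + √(log(1/δ)/(2m))` and
`ℓ^δ(z,m) ≥ min{ξ ∈ [0,q̂] : K(q̂,ξ) ≤ log(1/δ)/m} ≥ q̂ - √(log(1/δ)/(2m))`. -/
theorem clopper_pearson_kl_bounds
    (m : ℕ) (hm : 0 < m) (z : ℕ) (hz : z ≤ m) (δ : ℝ) (hδ : δ ∈ Set.Ioo (0 : ℝ) 1) :
    (cpUpper δ z m ≤ sSup (upKraw ((z : ℝ) / m) (Real.log (1 / δ) / m)) ∧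
      sSup (upKraw ((z : ℝ) / m) (Real.log (1 / δ) / m))
        ≤ (z : ℝ) / m + Real.sqrt (Real.log (1 / δ) / (2 * m))) ∧
    (sInf (loKraw ((z : ℝ) / m) (Real.log (1 / δ) / m)) ≤ cpLower δ z m ∧
      (z : ℝ) / m - Real.sqrt (Real.log (1 / δ) / (2 * m))
        ≤ sInf (loKraw ((z : ℝ) / m) (Real.log (1 / δ) / m))) := by
  obtain ⟨hδ0, hδ1⟩ := hδ
  have hm' : (0 : ℝ) < m := Nat.cast_pos.2 hm
  have hq : 0 ≤ (z : ℝ) / m := by positivity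
  have hq1 : (z : ℝ) / m ≤ 1 := (div_le_one hm').2 (by exact_mod_cast hz)
  have hγ : 0 ≤ Real.log (1 / δ) / m :=
    div_nonneg (Real.log_nonneg ((one_le_div hδ0).2 hδ1.le)) hm'.le
  have hcompl : ((m - z : ℕ) : ℝ) / m = 1 - (z : ℝ) / m := by
    rw [Nat.cast_sub hz, sub_div, div_self hm'.ne']
  rw [show Real.log (1 / δ) / (2 * m) = Real.log (1 / δ) / m / 2 by rw [div_div, mul_comm]]
  have hup := self_mem_upKraw hq1 hγ
  have hlo : (z : ℝ) / m ∈ loKraw ((z : ℝ) / m) (Real.log (1 / δ) / m) :=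
    one_sub_mem_upKraw_iff.1 (self_mem_upKraw (by linarith) hγ)
  have hbddUp : BddAbove (upKraw ((z : ℝ) / m) (Real.log (1 / δ) / m)) := ⟨1, fun _ h => h.1.2⟩
  have hbddLo : BddBelow (loKraw ((z : ℝ) / m) (Real.log (1 / δ) / m)) := ⟨0, fun _ h => h.1.1⟩
  refine ⟨⟨?_, csSup_le ⟨_, hup⟩ fun ξ h => le_add_sqrt_of_mem_upKraw hq h⟩,
    ?_, le_csInf ⟨_, hlo⟩ fun ξ h => ?_⟩
  · refine Real.sSup_le ?_ (hq.trans (le_csSup hbddUp hup))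
    rintro ξ ⟨hξ, h⟩
    rcases le_or_mem_upKraw_of_le_pbin hm hz hδ0 hξ.2 h with h | h
    · exact h.trans (le_csSup hbddUp hup)
    · exact le_csSup hbddUp h
  · rw [cpLower]
    split_ifs with hz0
    · subst hz0
      simpa using csInf_le hbddLo hlo
    · refine le_csInf ⟨1, ⟨by norm_num, le_rfl⟩, ?_⟩ ?_
      · rw [pbin_one (by omega)]
        linarith
      rintro ξ ⟨hξ, h⟩
      have hadd := pbin_add_pbin_one_sub hz0 hz ξ
      have := le_or_mem_upKraw_of_le_pbin hm (Nat.sub_le m z) hδ0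
        (sub_le_self 1 hξ.1) (by linarith)
      rw [hcompl, one_sub_mem_upKraw_iff] at this
      rcases this with h | h
      · exact (csInf_le hbddLo hlo).trans (by linarith)
      · exact csInf_le hbddLo h
  · have := le_add_sqrt_of_mem_upKraw (sub_nonneg.2 hq1) (one_sub_mem_upKraw_iff.2 h)
    linarith
end

section
/- Let x_1 ≤ … ≤ x_n be real covariates, (Y_1,…,Y_n) ∈ ℝ^n an arbitrary observation vector, and p̂ an isotonic function minimizing Σ_{i=1}^n {Y_i − p̂(x_i)}². Fix τ > 0 and for each i = 1,…,n set U_i = min{ Z^{iso}_{jk}/n_{jk} + τ/sqrt(n_{jk}) : (j,k) ∈ J, x_j ≥ x_i } and L_i = max{ Z^{iso}_{jk}/n_{jk} − τ/sqrt(n_{jk}) : (j,k) ∈ J, x_k ≤ x_i }. Then the minimum defining U_i is attained at some (j,k) ∈ J with j = min{s : x_s ≥ x_i} and (p̂(x_k) < p̂(x_{k+1}) or k = n), and the maximum defining L_i is attained at some (j,k) ∈ J with (p̂(x_{j−1}) < p̂(x_j) or j = 1) and k = max{s : x_s ≤ x_i}. -/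
open Finset

/-- The quantity `Z^{iso}_{jk}/n_{jk} + τ/√(n_{jk})` appearing in `U_i`. -/
noncomputable def ybValU (n : ℕ) (x : Fin n → ℝ) (phat : ℝ → ℝ) (τ : ℝ)
    (j k : Fin n) : ℝ :=
  (∑ i ∈ Finset.Icc j k, phat (x i)) / (((k : ℕ) - (j : ℕ) + 1 : ℕ) : ℝ) +
    τ / Real.sqrt (((k : ℕ) - (j : ℕ) + 1 : ℕ) : ℝ)

/-- The quantity `Z^{iso}_{jk}/n_{jk} - τ/√(n_{jk})` appearing in `L_i`. -/
noncomputable def ybValL (n : ℕ) (x : Fin n → ℝ) (phat : ℝ → ℝ) (τ : ℝ)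
    (j k : Fin n) : ℝ :=
  (∑ i ∈ Finset.Icc j k, phat (x i)) / (((k : ℕ) - (j : ℕ) + 1 : ℕ) : ℝ) -
    τ / Real.sqrt (((k : ℕ) - (j : ℕ) + 1 : ℕ) : ℝ)

/-- The average of `G` over `{j, …, k}` plus `τ / √(k - j + 1)`, for sequences indexed by `ℕ`. -/
noncomputable def upperAvg (G : ℕ → ℝ) (τ : ℝ) (j k : ℕ) : ℝ :=
  (∑ m ∈ Ico j (k + 1), G m) / ((k - j + 1 : ℕ) : ℝ) + τ / √((k - j + 1 : ℕ) : ℝ)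

lemma upperAvg_le_of_start_le {G : ℕ → ℝ} (hG : Monotone G) {τ : ℝ} (hτ : 0 ≤ τ) {i j k : ℕ}
    (hij : i ≤ j) (hjk : j ≤ k) : upperAvg G τ i k ≤ upperAvg G τ j k := by
  have hsplit := Finset.sum_Ico_consecutive G hij (show j ≤ k + 1 by lia)
  have hleft : ∑ m ∈ Ico i j, G m ≤ ((j - i : ℕ) : ℝ) * G j := by
    have := Finset.sum_le_card_nsmul (Ico i j) G (G j)
      fun m hm => hG (Finset.mem_Ico.1 hm).2.le
    simpa using this
  have hright : ((k - j + 1 : ℕ) : ℝ) * G j ≤ ∑ m ∈ Ico j (k + 1), G m := by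
    have := Finset.card_nsmul_le_sum (Ico j (k + 1)) G (G j)
      fun m hm => hG (Finset.mem_Ico.1 hm).1
    rwa [Nat.card_Ico, nsmul_eq_mul, show k + 1 - j = k - j + 1 by lia] at this
  have hlen : ((k - i + 1 : ℕ) : ℝ) = ((j - i : ℕ) : ℝ) + ((k - j + 1 : ℕ) : ℝ) := by
    rw [← Nat.cast_add]; congr 1; lia
  have hp : (0 : ℝ) ≤ ((j - i : ℕ) : ℝ) := Nat.cast_nonneg _
  have hq : (0 : ℝ) < ((k - j + 1 : ℕ) : ℝ) := by positivity
  unfold upperAvg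
  rw [← hsplit, hlen]
  generalize ((j - i : ℕ) : ℝ) = p at *
  generalize ((k - j + 1 : ℕ) : ℝ) = q at *
  refine add_le_add ?_ ?_
  · rw [div_le_div_iff₀ (by linarith) hq]
    nlinarith [mul_le_mul_of_nonneg_right hleft hq.le, mul_le_mul_of_nonneg_left hright hp]
  · exact div_le_div_of_nonneg_left hτ (Real.sqrt_pos.2 hq) (Real.sqrt_le_sqrt (by linarith))

lemma concave_sqrt_inv_le_or_le {c τ l m r : ℝ} (hc : 0 ≤ c) (hl : 0 < l) (hlm : l ≤ m)
    (hmr : m ≤ r) :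
    τ / √l - c / l ≤ τ / √m - c / m ∨ τ / √r - c / r ≤ τ / √m - c / m := by
  have hm := hl.trans_le hlm
  have hr := hm.trans_le hmr
  have hsq : ∀ t : ℝ, 0 < t → τ / √t - c / t = τ * (1 / √t) - c * (1 / √t) ^ 2 := by
    intro t ht
    rw [div_pow, Real.sq_sqrt ht.le]
    ring
  rw [hsq l hl, hsq m hm, hsq r hr]
  have hml : 1 / √m ≤ 1 / √l :=
    one_div_le_one_div_of_le (Real.sqrt_pos.2 hl) (Real.sqrt_le_sqrt hlm)
  have hrm : 1 / √r ≤ 1 / √m :=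
    one_div_le_one_div_of_le (Real.sqrt_pos.2 hm) (Real.sqrt_le_sqrt hmr)
  generalize 1 / √l = a at *
  generalize 1 / √m = b at *
  generalize 1 / √r = d at *
  rcases le_or_gt τ (c * (a + b)) with h | h
  · left
    nlinarith [mul_nonneg (sub_nonneg.2 hml) (sub_nonneg.2 h)]
  · right
    have : c * (b + d) ≤ τ := by nlinarith
    nlinarith [mul_nonneg (sub_nonneg.2 hrm) (sub_nonneg.2 this)]

/-- On a block where `G` equals `v`, the mean has the form `v - c / length` with fixed `c`. -/
lemma upperAvg_eq_of_const {G : ℕ → ℝ} {τ v : ℝ} {j a k : ℕ} (hja : j ≤ a) (hjk : j ≤ k)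
    (hak : a ≤ k + 1) (hv : ∀ m, a ≤ m → m ≤ k → G m = v) :
    upperAvg G τ j k = v + (τ / √((k - j + 1 : ℕ) : ℝ) -
      (((a - j : ℕ) : ℝ) * v - ∑ m ∈ Ico j a, G m) / ((k - j + 1 : ℕ) : ℝ)) := by
  have hconst : ∑ m ∈ Ico a (k + 1), G m = ((k + 1 - a : ℕ) : ℝ) * v := by
    rw [Finset.sum_congr rfl fun m hm =>
      hv m (Finset.mem_Ico.1 hm).1 (Nat.lt_succ_iff.1 (Finset.mem_Ico.1 hm).2)]
    simp
  have hlen : ((k - j + 1 : ℕ) : ℝ) = ((a - j : ℕ) : ℝ) + ((k + 1 - a : ℕ) : ℝ) := by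
    rw [← Nat.cast_add]; congr 1; lia
  have hpos : (0 : ℝ) < ((k - j + 1 : ℕ) : ℝ) := by positivity
  unfold upperAvg
  rw [← Finset.sum_Ico_consecutive G hja hak, hconst]
  have : ((k + 1 - a : ℕ) : ℝ) = ((k - j + 1 : ℕ) : ℝ) - ((a - j : ℕ) : ℝ) := by linarith
  rw [this]
  field_simp
  ring

lemma exists_block_end_upperAvg_le {G : ℕ → ℝ} (hG : Monotone G) {τ : ℝ} (hτ : 0 ≤ τ)
    {n j k : ℕ} (hjk : j ≤ k) (hk : k < n) :
    ∃ e, j ≤ e ∧ e < n ∧ (e + 1 = n ∨ G e < G (e + 1)) ∧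
      upperAvg G τ j e ≤ upperAvg G τ j k := by
  classical
  have hexb : ∃ b, k ≤ b ∧ (b + 1 = n ∨ G k < G (b + 1)) := ⟨n - 1, by lia, by lia⟩
  have hexa : ∃ a, j ≤ a ∧ G a = G k := ⟨k, hjk, rfl⟩
  obtain ⟨b, ⟨hkb, hb⟩, hbmin⟩ : ∃ b, (k ≤ b ∧ (b + 1 = n ∨ G k < G (b + 1))) ∧
      ∀ m < b, ¬ (k ≤ m ∧ (m + 1 = n ∨ G k < G (m + 1))) :=
    ⟨_, Nat.find_spec hexb, fun _ => Nat.find_min hexb⟩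
  obtain ⟨a, ⟨hja, ha⟩, hamin⟩ : ∃ a, (j ≤ a ∧ G a = G k) ∧
      ∀ m < a, ¬ (j ≤ m ∧ G m = G k) :=
    ⟨_, Nat.find_spec hexa, fun _ => Nat.find_min hexa⟩
  have hak : a ≤ k := by
    by_contra! h
    exact hamin k h ⟨hjk, rfl⟩
  have hbn : b < n := by
    by_contra! h
    exact hbmin (n - 1) (by lia) ⟨by lia, Or.inl (by lia)⟩
  have hGb : G b = G k := by
    rcases hkb.eq_or_lt with h | h
    · rw [h]
    · refine le_antisymm ?_ (hG hkb)
      have := hbmin (b - 1) (by lia)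
      rw [show b - 1 + 1 = b by lia] at this
      by_contra! h'
      exact this ⟨by lia, Or.inr h'⟩
  have hconst : ∀ m, a ≤ m → m ≤ b → G m = G k := fun m h₁ h₂ =>
    le_antisymm ((hG h₂).trans hGb.le) (ha.ge.trans (hG h₁))
  have hbend : b + 1 = n ∨ G b < G (b + 1) := by rwa [hGb]
  have hkm : ((k - j + 1 : ℕ) : ℝ) ≤ ((b - j + 1 : ℕ) : ℝ) := by
    rw [Nat.cast_le]; lia
  have hkpos : (0 : ℝ) < ((k - j + 1 : ℕ) : ℝ) := by positivity
  have hek := upperAvg_eq_of_const (τ := τ) hja hjk (by lia)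
    fun m h₁ h₂ => hconst m h₁ (h₂.trans hkb)
  have heb := upperAvg_eq_of_const (τ := τ) hja (hjk.trans hkb) (by lia) hconst
  rcases hja.eq_or_lt with rfl | hlt
  · refine ⟨b, by lia, hbn, hbend, ?_⟩
    rw [hek, heb]
    simpa using div_le_div_of_nonneg_left hτ (Real.sqrt_pos.2 hkpos) (Real.sqrt_le_sqrt hkm)
  · have hea := upperAvg_eq_of_const (G := G) (τ := τ) (v := G k) (k := a - 1) hja (by lia)
      (by lia) fun m h₁ h₂ => by lia
    have haend : G (a - 1) < G (a - 1 + 1) := by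
      rw [show a - 1 + 1 = a by lia]
      refine lt_of_le_of_ne (hG (by lia)) fun h => hamin (a - 1) (by lia) ⟨by lia, h.trans ha⟩
    have hc : 0 ≤ ((a - j : ℕ) : ℝ) * G k - ∑ m ∈ Ico j a, G m := by
      have := Finset.sum_le_card_nsmul (Ico j a) G (G k)
        fun m hm => hG ((Finset.mem_Ico.1 hm).2.le.trans hak)
      simpa using this
    have hla : ((a - 1 - j + 1 : ℕ) : ℝ) ≤ ((k - j + 1 : ℕ) : ℝ) := by
      rw [Nat.cast_le]; lia
    rcases concave_sqrt_inv_le_or_le (τ := τ) hc (by positivity) hla hkm with h | h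
    · exact ⟨a - 1, by lia, by lia, Or.inr haend, by rw [hea, hek]; linarith⟩
    · exact ⟨b, by lia, hbn, hbend, by rw [heb, hek]; linarith⟩

lemma exists_block_end_forall_upperAvg_le {G : ℕ → ℝ} (hG : Monotone G) {τ : ℝ} (hτ : 0 ≤ τ)
    {n j : ℕ} (hj : j < n) :
    ∃ e, j ≤ e ∧ e < n ∧ (e + 1 = n ∨ G e < G (e + 1)) ∧
      ∀ j' k', j ≤ j' → j' ≤ k' → k' < n → upperAvg G τ j e ≤ upperAvg G τ j' k' := by
  classical
  obtain ⟨e, he, hmin⟩ := Finset.exists_min_image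
    ((Finset.range n).filter fun e => j ≤ e ∧ (e + 1 = n ∨ G e < G (e + 1)))
    (upperAvg G τ j) ⟨n - 1, by simp; lia⟩
  simp only [Finset.mem_filter, Finset.mem_range] at he hmin
  refine ⟨e, he.2.1, he.1, he.2.2, fun j' k' h₁ h₂ h₃ => ?_⟩
  obtain ⟨f, hjf, hfn, hf, hle⟩ := exists_block_end_upperAvg_le hG hτ (h₁.trans h₂) h₃
  exact (hmin f ⟨hfn, hjf, hf⟩).trans (hle.trans (upperAvg_le_of_start_le hG hτ h₁ h₂))

/-- The upper band is attained at a block end, for any isotonic `phat`. -/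
lemma exists_block_end_forall_ybValU_le {n : ℕ} {x : Fin n → ℝ} (hx : Monotone x)
    {phat : ℝ → ℝ} (hphat : Monotone phat) {τ : ℝ} (hτ : 0 ≤ τ) (i : Fin n) :
    ∃ jk ∈ idxJ n x,
      (x i ≤ x jk.1 ∧ ∀ s : Fin n, x i ≤ x s → jk.1 ≤ s) ∧
      ((jk.2 : ℕ) + 1 = n ∨
        ∃ k' : Fin n, (k' : ℕ) = (jk.2 : ℕ) + 1 ∧ phat (x jk.2) < phat (x k')) ∧
      (∀ jk' ∈ idxJ n x, x i ≤ x jk'.1 →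
        ybValU n x phat τ jk.1 jk.2 ≤ ybValU n x phat τ jk'.1 jk'.2) := by
  classical
  have hn : 0 < n := i.pos
  let G : ℕ → ℝ := fun m => phat (x ⟨min m (n - 1), by lia⟩)
  have hG : Monotone G := fun a b hab => hphat (hx (by
    rw [Fin.mk_le_mk]; exact min_le_min_right _ hab))
  have hGval : ∀ k : Fin n, G k = phat (x k) := fun k => by
    simp only [G]; congr 2; ext; simp; lia
  have hval : ∀ j k : Fin n, ybValU n x phat τ j k = upperAvg G τ j k := fun j k => by
    have hIco : Ico (j : ℕ) (k + 1) = (Finset.Icc j k).map Fin.valEmbedding := by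
      rw [Fin.map_valEmbedding_Icc]; ext m; simp
    rw [ybValU, upperAvg, hIco, Finset.sum_map]
    simp [hGval]
  obtain ⟨j, hj, hjmin⟩ := Finset.exists_min_image
    (Finset.univ.filter fun s : Fin n => x i ≤ x s) id ⟨i, by simp⟩
  simp only [Finset.mem_filter, Finset.mem_univ, true_and, id] at hj hjmin
  obtain ⟨e, hje, hen, he, hmin⟩ := exists_block_end_forall_upperAvg_le hG hτ j.isLt
  have hend : e + 1 = n ∨
      ∃ k' : Fin n, (k' : ℕ) = e + 1 ∧ phat (x ⟨e, hen⟩) < phat (x k') := by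
    refine he.imp_right fun h => ?_
    by_cases h' : e + 1 < n
    · exact ⟨⟨e + 1, h'⟩, rfl, by rwa [← hGval, ← hGval]⟩
    · have : G e = G (e + 1) := by
        simp only [G]; congr 3; lia
      exact absurd this h.ne
  refine ⟨(j, ⟨e, hen⟩), ⟨hje, fun s hs => ?_, fun s hs => ?_⟩, ⟨hj, hjmin⟩, hend,
    fun jk' hJ hle => ?_⟩
  · by_contra! h
    have := hjmin s (hj.trans h)
    rw [Fin.le_def] at this
    simp only at hs
    lia
  · rcases hend with h | ⟨k', hk', hlt⟩
    · have := s.isLt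
      simp only at hs
      lia
    · obtain rfl : k' = s := Fin.ext (hk'.trans hs)
      exact hphat.reflect_lt hlt
  · rw [hval, hval]
    exact hmin _ _ (hjmin _ hle) hJ.1 jk'.2.isLt

lemma ybValU_neg_rev {n : ℕ} (x : Fin n → ℝ) (phat : ℝ → ℝ) (τ : ℝ) (j k : Fin n) :
    ybValU n (fun s => -x s.rev) (fun t => -phat (-t)) τ j k =
      -ybValL n x phat τ k.rev j.rev := by
  have hsum : ∑ s ∈ Finset.Icc j k, phat (x s.rev) =
      ∑ s ∈ Finset.Icc k.rev j.rev, phat (x s) := by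
    refine Finset.sum_nbij' Fin.rev Fin.rev ?_ ?_ ?_ ?_ ?_ <;>
      simp +contextual [Fin.rev_le_iff, Fin.le_rev_iff]
  have hlen : (j.rev : ℕ) - (k.rev : ℕ) = k - j := by
    simp only [Fin.val_rev]; lia
  simp only [ybValU, ybValL, neg_neg, Finset.sum_neg_distrib, hsum, hlen]
  ring

lemma rev_mem_idxJ_iff {n : ℕ} (x : Fin n → ℝ) (j k : Fin n) :
    (j, k) ∈ idxJ n (fun s => -x s.rev) ↔ (k.rev, j.rev) ∈ idxJ n x := by
  simp only [idxJ, Set.mem_ofPred_eq, Fin.rev_le_rev, neg_lt_neg_iff]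
  refine and_congr_right fun _ => and_comm.trans (and_congr ?_ ?_) <;>
    rw [← Fin.revPerm.forall_congr_right] <;>
    refine forall_congr' fun s => ?_ <;>
    simp only [Fin.revPerm_apply, Fin.rev_rev, Fin.val_rev] <;>
    refine imp_congr_left ?_ <;> lia

/-- The lower band is attained at a block start, for any isotonic `phat`. -/
lemma exists_block_start_forall_ybValL_le {n : ℕ} {x : Fin n → ℝ} (hx : Monotone x)
    {phat : ℝ → ℝ} (hphat : Monotone phat) {τ : ℝ} (hτ : 0 ≤ τ) (i : Fin n) :
    ∃ jk ∈ idxJ n x,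
      ((jk.1 : ℕ) = 0 ∨
        ∃ j' : Fin n, (j' : ℕ) + 1 = (jk.1 : ℕ) ∧ phat (x j') < phat (x jk.1)) ∧
      (x jk.2 ≤ x i ∧ ∀ s : Fin n, x s ≤ x i → s ≤ jk.2) ∧
      (∀ jk' ∈ idxJ n x, x jk'.2 ≤ x i →
        ybValL n x phat τ jk'.1 jk'.2 ≤ ybValL n x phat τ jk.1 jk.2) := by
  obtain ⟨⟨j, k⟩, hJ, ⟨hj, hjmin⟩, hend, hmin⟩ := exists_block_end_forall_ybValU_le
    (x := fun s => -x s.rev) (fun a b hab => neg_le_neg (hx (Fin.rev_le_rev.2 hab)))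
    (phat := fun t => -phat (-t)) (fun a b hab => neg_le_neg (hphat (neg_le_neg hab))) hτ i.rev
  simp only [neg_neg, Fin.rev_rev, neg_le_neg_iff, neg_lt_neg_iff] at hj hjmin hend hmin
  refine ⟨(k.rev, j.rev), (rev_mem_idxJ_iff x j k).1 hJ, ?_, ⟨hj, fun s hs => ?_⟩,
    fun jk' hJ' hle => ?_⟩
  · refine hend.imp (fun h => ?_) fun ⟨k', hk', hlt⟩ => ⟨k'.rev, ?_, hlt⟩
    · simp only [Fin.val_rev]; lia
    · have := k'.isLt
      simp only [Fin.val_rev]; lia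
  · exact Fin.le_rev_iff.2 (hjmin s.rev (by simpa using hs))
  · have := hmin (jk'.2.rev, jk'.1.rev) ((rev_mem_idxJ_iff x _ _).2 (by simpa using hJ'))
      (by simpa using hle)
    rw [ybValU_neg_rev, ybValU_neg_rev] at this
    simpa using this

/-- **Proposition B1.** The minimum defining
`U_i = min{Z^{iso}_{jk}/n_{jk} + τ/√n_{jk} : (j,k) ∈ J, x_j ≥ x_i}` is attained at some
`(j,k) ∈ J` with `j = min{s : x_s ≥ x_i}` and (`p̂(x_k) < p̂(x_{k+1})` or `k = n`); the
maximum defining `L_i = max{Z^{iso}_{jk}/n_{jk} - τ/√n_{jk} : (j,k) ∈ J, x_k ≤ x_i}` is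
attained at some `(j,k) ∈ J` with (`p̂(x_{j-1}) < p̂(x_j)` or `j = 1`) and
`k = max{s : x_s ≤ x_i}`. -/
theorem yb_band_attained_at_block_ends
    (n : ℕ) (hn : 0 < n) (x : Fin n → ℝ) (hx : Monotone x)
    (Y : Fin n → ℝ) (phat : ℝ → ℝ) (hphat : IsIsoFit n x Y phat)
    (τ : ℝ) (hτ : 0 < τ) (i : Fin n) :
    (∃ jk ∈ idxJ n x,
      (x i ≤ x jk.1 ∧ ∀ s : Fin n, x i ≤ x s → jk.1 ≤ s) ∧
      ((jk.2 : ℕ) + 1 = n ∨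
        ∃ k' : Fin n, (k' : ℕ) = (jk.2 : ℕ) + 1 ∧ phat (x jk.2) < phat (x k')) ∧
      (∀ jk' ∈ idxJ n x, x i ≤ x jk'.1 →
        ybValU n x phat τ jk.1 jk.2 ≤ ybValU n x phat τ jk'.1 jk'.2)) ∧
    (∃ jk ∈ idxJ n x,
      ((jk.1 : ℕ) = 0 ∨
        ∃ j' : Fin n, (j' : ℕ) + 1 = (jk.1 : ℕ) ∧ phat (x j') < phat (x jk.1)) ∧
      (x jk.2 ≤ x i ∧ ∀ s : Fin n, x s ≤ x i → s ≤ jk.2) ∧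
      (∀ jk' ∈ idxJ n x, x jk'.2 ≤ x i →
        ybValL n x phat τ jk'.1 jk'.2 ≤ ybValL n x phat τ jk.1 jk.2)) := by
  exact ⟨exists_block_end_forall_ybValU_le hx hphat.1 hτ.le i,
    exists_block_start_forall_ybValL_le hx hphat.1 hτ.le i⟩
end
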